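/- Let Γ act on a simplicial tree T without edge inversions, with quotient graph of groups based at c and Bass–Serre base vertex c̃. Let V = T T_V U_V and W = T T_W U_W be two words in the language L (normal-form prefix followed by a geodesic word in Γ_c), where T is the longest common syllable prefix of their tree parts, T_V and T_W are the remaining tree parts of syllable lengths n−j and m−j respectively. If d_T(π(V)·c̃, π(W)·c̃) ≤ η, then (n−j) + (m−j) ≤ η. -/

import Mathlib

/-- `IsEdgePath ι bar v p w` says the list of directed edges `p` forms an edge path in the
graph from `v` to `w`, where `ι` gives the initial vertex of an edge and `bar` reverses
edges (so the terminal vertex of `e` is `ι (bar e)`). -/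
def IsEdgePath {V E : Type} (ι : E → V) (bar : E → E) : V → List E → V → Prop
  | v, [], w => v = w
  | v, e :: p, w => ι e = v ∧ IsEdgePath ι bar (ι (bar e)) p w

/-- The defining relations of the fundamental group of a graph of groups: vertex group
multiplication, `ē = e⁻¹`, the edge relations `e⁻¹ i_e(h) e = i_{ē}(ω_e h)`, and `e = 1`
for edges of the chosen maximal subtree. -/
def gogRels {V E : Type} (ι : E → V) (bar : E → E) (Γv : V → Type) [∀ v, Group (Γv v)]
    (H : E → Type) [∀ e, Group (H e)] (ω : ∀ e, H e ≃* H (bar e))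
    (i : ∀ e, H e →* Γv (ι e)) (Etree : Set E) :
    Set (FreeGroup ((Σ v, Γv v) ⊕ E)) :=
  {r | (∃ (v : V) (g h : Γv v),
          r = FreeGroup.of (.inl ⟨v, g⟩) * FreeGroup.of (.inl ⟨v, h⟩) *
              (FreeGroup.of (.inl ⟨v, g * h⟩))⁻¹) ∨
       (∃ e : E, r = FreeGroup.of (.inr e) * FreeGroup.of (.inr (bar e))) ∨
       (∃ (e : E) (h : H e),
          r = (FreeGroup.of (.inr e))⁻¹ * FreeGroup.of (.inl ⟨ι e, i e h⟩) *
              FreeGroup.of (.inr e) *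
              (FreeGroup.of (.inl ⟨ι (bar e), i (bar e) (ω e h)⟩))⁻¹) ∨
       (∃ e ∈ Etree, r = FreeGroup.of (.inr e))}

/-- The fundamental group of a graph of groups, as a presented group. -/
def GoGFundGroup {V E : Type} (ι : E → V) (bar : E → E) (Γv : V → Type)
    [∀ v, Group (Γv v)] (H : E → Type) [∀ e, Group (H e)] (ω : ∀ e, H e ≃* H (bar e))
    (i : ∀ e, H e →* Γv (ι e)) (Etree : Set E) :=
  PresentedGroup (gogRels ι bar Γv H ω i Etree)

instance {V E : Type} (ι : E → V) (bar : E → E) (Γv : V → Type)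
    [∀ v, Group (Γv v)] (H : E → Type) [∀ e, Group (H e)] (ω : ∀ e, H e ≃* H (bar e))
    (i : ∀ e, H e →* Γv (ι e)) (Etree : Set E) :
    Group (GoGFundGroup ι bar Γv H ω i Etree) := by
  unfold GoGFundGroup; infer_instance

section
variable {V E : Type} (ι : E → V) (bar : E → E) (Γv : V → Type)
    [∀ v, Group (Γv v)] (H : E → Type) [∀ e, Group (H e)] (ω : ∀ e, H e ≃* H (bar e))
    (i : ∀ e, H e →* Γv (ι e)) (Etree : Set E)

/-- The image of a vertex group element in the fundamental group. -/
def embV (v : V) (x : Γv v) : GoGFundGroup ι bar Γv H ω i Etree :=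
  PresentedGroup.of (.inl ⟨v, x⟩)

/-- The image of a directed edge in the fundamental group. -/
def embE (e : E) : GoGFundGroup ι bar Γv H ω i Etree :=
  PresentedGroup.of (.inr e)

/-- The element `s₁e₁s₂e₂⋯sₙeₙ` of the fundamental group determined by a list of
syllables `⟨eₖ, sₖ⟩`. -/
def nfWord (l : List (Σ e : E, Γv (ι e))) : GoGFundGroup ι bar Γv H ω i Etree :=
  (l.map (fun p => embV ι bar Γv H ω i Etree (ι p.1) p.2 * embE ι bar Γv H ω i Etree p.1)).prod

/-- The conditions for `(l, h)` to be a normal form based at `c` with respect to the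
transversals `S`: the edges form a loop at `c`, each `sₖ` lies in the transversal
`S(eₖ)`, and `sₖ ≠ 1` whenever `e_{k-1} = ē_k`. -/
def IsNormalForm (S : ∀ e : E, Set (Γv (ι e))) (c : V) (l : List (Σ e : E, Γv (ι e))) : Prop :=
  IsEdgePath ι bar c (l.map Sigma.fst) c ∧
  (∀ p ∈ l, p.2 ∈ S p.1) ∧
  l.Chain' (fun p q => q.1 = bar p.1 → q.2 ≠ (1 : Γv (ι q.1)))

end

section BassSerre
variable {V E : Type} (ι : E → V) (bar : E → E) (Γv : V → Type)
    [∀ v, Group (Γv v)] (H : E → Type) [∀ e, Group (H e)] (ω : ∀ e, H e ≃* H (bar e))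
    (i : ∀ e, H e →* Γv (ι e)) (Etree : Set E)

/-- The vertices of the Bass–Serre tree: for each vertex `v` of the quotient graph, the
cosets of the image of the vertex group `Γ_v` in the fundamental group. -/
def bsVert : Type :=
  Σ v : V, GoGFundGroup ι bar Γv H ω i Etree ⧸
    Subgroup.closure (Set.range (embV ι bar Γv H ω i Etree v))

/-- One oriented edge of the Bass–Serre tree: `gΓ_{ι e}` is joined to `g·e·Γ_{ι ē}`. -/
def bsAdjOne (x y : bsVert ι bar Γv H ω i Etree) : Prop :=
  ∃ (e : E) (g : GoGFundGroup ι bar Γv H ω i Etree),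
    x = ⟨ι e, QuotientGroup.mk g⟩ ∧
    y = ⟨ι (bar e), QuotientGroup.mk (g * embE ι bar Γv H ω i Etree e)⟩

/-- Adjacency in the Bass–Serre tree. -/
def bsAdj (x y : bsVert ι bar Γv H ω i Etree) : Prop :=
  bsAdjOne ι bar Γv H ω i Etree x y ∨ bsAdjOne ι bar Γv H ω i Etree y x

end BassSerre

/-- `relPath R x p y`: the list `p` is the list of successive vertices (after `x`) of a
path from `x` to `y` along the relation `R`. -/
def relPath {X : Type} (R : X → X → Prop) : X → List X → X → Prop
  | x, [], y => x = y
  | x, z :: p, y => R x z ∧ relPath R z p y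

/-- The combinatorial distance determined by a relation `R`. -/
noncomputable def relDist {X : Type} (R : X → X → Prop) (x y : X) : ℕ :=
  sInf {n : ℕ | ∃ p : List X, p.length = n ∧ relPath R x p y}


namespace GraphOfGroups

/-- Two lists are near if they agree up to adding or removing one head element. -/
def Near {α : Type} (r r' : List α) : Prop :=
  r = r' ∨ (∃ p, r' = p :: r) ∨ ∃ p, r = p :: r'

theorem Near.symm {α : Type} {r r' : List α} (h : Near r r') : Near r' r := by
  rcases h with h | h | h
  exacts [.inl h.symm, .inr (.inr h), .inr (.inl h)]

/-- A walk of `n` near steps splits off a common tail with remainders of total length at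
most `n`. -/
theorem exists_common_tail {X α : Type} {R : X → X → Prop} {f : X → List α}
    (hf : ∀ x y, R x y → Near (f x) (f y)) (A : List α) (p : List X) :
    ∀ (x y : X) (a b P : List α), A = a ++ P → f x = b ++ P → relPath R x p y →
      ∃ a' b' P' : List α, A = a' ++ P' ∧ f y = b' ++ P' ∧
        a'.length + b'.length ≤ a.length + b.length + p.length := by
  induction p with
  | nil =>
    rintro x y a b P hA hx rfl
    exact ⟨a, b, P, hA, hx, le_rfl⟩
  | cons z p ih =>
    rintro x y a b P hA hx ⟨hxz, hp⟩
    obtain ⟨a₁, b₁, P₁, h₁, h₂, h₃⟩ : ∃ a₁ b₁ P₁ : List α, A = a₁ ++ P₁ ∧ f z = b₁ ++ P₁ ∧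
        a₁.length + b₁.length ≤ a.length + b.length + 1 := by
      rcases hf x z hxz with h | ⟨q, h⟩ | ⟨q, h⟩
      · exact ⟨a, b, P, hA, h ▸ hx, by omega⟩
      · exact ⟨a, q :: b, P, hA, by rw [h, hx]; rfl, by simp; omega⟩
      · rw [hx] at h
        cases b with
        | nil => exact ⟨a ++ [q], [], f z, by simpa [← h] using hA, rfl, by simp⟩
        | cons q' b =>
          simp only [List.cons_append, List.cons.injEq] at h
          exact ⟨a, b, P, hA, h.2.symm, by simp; omega⟩
    obtain ⟨a', b', P', h₁', h₂', h₃'⟩ := ih z y a₁ b₁ P₁ h₁ h₂ hp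
    exact ⟨a', b', P', h₁', h₂', by simp; omega⟩

theorem length_le_of_append_eq {α : Type} {T l₁ l₂ P a b : List α}
    (hmax : ∀ x, l₁.head? = some x → l₂.head? ≠ some x)
    (h₁ : T ++ l₁ = P ++ a) (h₂ : T ++ l₂ = P ++ b) :
    l₁.length + l₂.length ≤ a.length + b.length := by
  induction T generalizing P with
  | nil =>
    cases P with
    | nil => simp at h₁ h₂; subst h₁ h₂; rfl
    | cons x P => simp at h₁ h₂; subst h₁ h₂; simp at hmax
  | cons t T ih =>
    cases P with
    | nil =>
      simp at h₁ h₂; subst h₁ h₂; simp; omega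
    | cons x P =>
      simp at h₁ h₂
      exact ih h₁.2 h₂.2

theorem relPath_append {X : Type} {R : X → X → Prop} {p q : List X} {x y z : X}
    (hp : relPath R x p y) (hq : relPath R y q z) : relPath R x (p ++ q) z := by
  induction p generalizing x with
  | nil => cases hp; exact hq
  | cons w p ih => exact ⟨hp.1, ih hp.2⟩

theorem exists_relPath_symm {X : Type} {R : X → X → Prop} (hR : ∀ x y, R x y → R y x)
    {p : List X} {x y : X} (hp : relPath R x p y) : ∃ q, relPath R y q x := by
  induction p generalizing x with
  | nil => cases hp; exact ⟨[], rfl⟩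
  | cons w p ih =>
    obtain ⟨q, hq⟩ := ih hp.2
    exact ⟨q ++ [x], relPath_append hq ⟨hR _ _ hp.1, rfl⟩⟩

section EdgePath
variable {V E : Type} {ι : E → V} {bar : E → E}

theorem isEdgePath_append {p q : List E} {u w : V} :
    IsEdgePath ι bar u (p ++ q) w ↔ ∃ v, IsEdgePath ι bar u p v ∧ IsEdgePath ι bar v q w := by
  induction p generalizing u with
  | nil => simp [IsEdgePath]
  | cons e p ih => simp [IsEdgePath, ih, and_assoc]

theorem IsEdgePath.reverse (hbar_bar : ∀ e, bar (bar e) = e) {p : List E} {v w : V}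
    (hp : IsEdgePath ι bar v p w) : IsEdgePath ι bar w (p.map bar).reverse v := by
  induction p generalizing v with
  | nil => exact hp.symm
  | cons e p ih =>
    simp only [List.map_cons, List.reverse_cons, isEdgePath_append]
    exact ⟨_, ih hp.2, rfl, by simpa [IsEdgePath, hbar_bar] using hp.1⟩

variable {P : Type} [Group P] {b : E → P}

theorem prod_map_bar_reverse (hb : ∀ e, b e * b (bar e) = 1) (p : List E) :
    (((p.map bar).reverse).map b).prod = ((p.map b).prod)⁻¹ := by
  induction p with
  | nil => simp
  | cons e p ih =>
    simp only [List.map_cons, List.reverse_cons, List.map_append, List.prod_append, ih]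
    simp [eq_inv_of_mul_eq_one_right (hb e)]

/-- Closed paths in a forest have trivial product. -/
theorem prod_eq_one_of_closed (hbar_bar : ∀ e, bar (bar e) = e) {Etree : Set E}
    (htree_acyc : ∀ (v : V) (p : List E), p ≠ [] → (∀ e ∈ p, e ∈ Etree) →
      p.IsChain (fun e f => f ≠ bar e) → IsEdgePath ι bar v p v → False)
    (hb : ∀ e, b e * b (bar e) = 1) (p : List E) {v : V} (hpt : ∀ e ∈ p, e ∈ Etree)
    (hp : IsEdgePath ι bar v p v) : (p.map b).prod = 1 := by
  induction hn : p.length using Nat.strong_induction_on generalizing p with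
  | _ n ih =>
  by_cases hnil : p = []
  · simp [hnil]
  have hc : ¬ p.IsChain (fun e f => f ≠ bar e) := fun hc => htree_acyc v p hnil hpt hc hp
  obtain ⟨l₁, e, l₂, rfl⟩ : ∃ l₁ e l₂, p = l₁ ++ e :: bar e :: l₂ := by
    simp only [List.isChain_iff_forall_rel_of_append_cons_cons] at hc
    push Not at hc
    obtain ⟨x, y, l₁, l₂, h, rfl⟩ := hc
    exact ⟨_, _, _, h⟩
  obtain ⟨w, h₁, h₂, -, h₃⟩ := isEdgePath_append.1 hp
  have h₄ : IsEdgePath ι bar v (l₁ ++ l₂) v :=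
    isEdgePath_append.2 ⟨w, h₁, by rwa [hbar_bar, h₂] at h₃⟩
  have := ih (l₁ ++ l₂).length (by simp at hn ⊢; omega) (l₁ ++ l₂)
    (fun f hf => hpt f (by simp at hf ⊢; tauto)) h₄ rfl
  simp only [List.map_append, List.prod_append, List.map_cons, List.prod_cons] at this ⊢
  rw [← mul_assoc (b e), hb, one_mul, this]

end EdgePath

section Hom
variable {V E : Type} {ι : E → V} {bar : E → E} {Γv : V → Type}
    [∀ v, Group (Γv v)] {H : E → Type} [∀ e, Group (H e)] {ω : ∀ e, H e ≃* H (bar e)}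
    {i : ∀ e, H e →* Γv (ι e)} {Etree : Set E} {P : Type} [Group P]

/-- A representation of the path group of a graph of groups induces one of the fundamental
group, after conjugating by products along paths of the maximal tree. -/
theorem exists_hom (hbar_bar : ∀ e, bar (bar e) = e)
    (htree_bar : ∀ e ∈ Etree, bar e ∈ Etree)
    (htree_conn : ∀ v w : V, ∃ p : List E, (∀ e ∈ p, e ∈ Etree) ∧ IsEdgePath ι bar v p w)
    (htree_acyc : ∀ (v : V) (p : List E), p ≠ [] → (∀ e ∈ p, e ∈ Etree) →
      p.IsChain (fun e f => f ≠ bar e) → IsEdgePath ι bar v p v → False)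
    (c : V) (a : ∀ v, Γv v →* P) (b : E → P) (hb : ∀ e, b e * b (bar e) = 1)
    (hab : ∀ e h, a (ι e) (i e h) * b e = b e * a (ι (bar e)) (i (bar e) (ω e h))) :
    ∃ (φ : GoGFundGroup ι bar Γv H ω i Etree →* P) (τ : V → P), τ c = 1 ∧
      (∀ v x, φ (embV ι bar Γv H ω i Etree v x) * τ v = τ v * a v x) ∧
      ∀ e, φ (embE ι bar Γv H ω i Etree e) * τ (ι (bar e)) = τ (ι e) * b e := by
  choose p hpt hp using htree_conn c
  have closed := @prod_eq_one_of_closed V E ι bar P _ b hbar_bar Etree htree_acyc hb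
  set τ : V → P := fun v => ((p v).map b).prod with hτ
  have htree : ∀ e ∈ Etree, τ (ι e) * b e * (τ (ι (bar e)))⁻¹ = 1 := by
    intro e he
    have := closed (p (ι e) ++ e :: ((p (ι (bar e))).map bar).reverse) (v := c) ?_ ?_
    · rw [List.map_append, List.prod_append, List.map_cons, List.prod_cons,
        prod_map_bar_reverse hb, ← mul_assoc] at this
      exact this
    · intro f hf
      simp only [List.mem_append, List.mem_cons, List.mem_reverse, List.mem_map] at hf
      rcases hf with hf | rfl | ⟨f, hf, rfl⟩
      exacts [hpt _ _ hf, he, htree_bar _ (hpt _ _ hf)]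
    · exact isEdgePath_append.2 ⟨_, hp _, rfl, IsEdgePath.reverse hbar_bar (hp _)⟩
  let f : (Σ v, Γv v) ⊕ E → P := Sum.elim (fun x => τ x.1 * a x.1 x.2 * (τ x.1)⁻¹)
    (fun e => τ (ι e) * b e * (τ (ι (bar e)))⁻¹)
  have hf : ∀ r ∈ gogRels ι bar Γv H ω i Etree, FreeGroup.lift f r = 1 := by
    rintro r (⟨v, g, h, rfl⟩ | ⟨e, rfl⟩ | ⟨e, h, rfl⟩ | ⟨e, he, rfl⟩)
    · simp [f]; group
    · have h₁ := hb e
      have h₂ : b (bar e) = (b e)⁻¹ := eq_inv_of_mul_eq_one_right h₁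
      simp only [f, map_mul, FreeGroup.lift_apply_of, Sum.elim_inr, hbar_bar, h₂]
      group
    · have h₁ := hab e h
      rw [← eq_mul_inv_iff_mul_eq] at h₁
      simp [f, h₁, mul_assoc]
    · simpa [f] using htree e he
  refine ⟨PresentedGroup.toGroup hf, τ, closed _ (hpt c) (hp c), fun v x => ?_, fun e => ?_⟩
  · have : PresentedGroup.toGroup hf (PresentedGroup.of (.inl ⟨v, x⟩)) = f (.inl ⟨v, x⟩) :=
      PresentedGroup.toGroup.of hf
    change PresentedGroup.toGroup hf (PresentedGroup.of (.inl ⟨v, x⟩)) * _ = _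
    rw [this]; simp [f]
  · have : PresentedGroup.toGroup hf (PresentedGroup.of (.inr e)) = f (.inr e) :=
      PresentedGroup.toGroup.of hf
    change PresentedGroup.toGroup hf (PresentedGroup.of (.inr e)) * _ = _
    rw [this]; simp [f]

end Hom

section Action
variable {V E : Type} {ι : E → V} {bar : E → E} {Γv : V → Type}
    [∀ v, Group (Γv v)] {H : E → Type} [∀ e, Group (H e)]

/-- A vertex `v`, a list of syllables (last syllable first) and an element of `Γ_v`. -/
abbrev State (ι : E → V) (Γv : V → Type) : Type :=
  Σ v, List (Σ e : E, Γv (ι e)) × Γv v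

variable (bar) in
/-- Normal-form lists of syllables, last syllable first and without condition on end
points. -/
def IsReduced (S : ∀ e : E, Set (Γv (ι e))) (r : List (Σ e : E, Γv (ι e))) : Prop :=
  (∀ p ∈ r, p.2 ∈ S p.1) ∧
    r.IsChain (fun q p => q.1 = bar p.1 → q.2 ≠ (1 : Γv (ι q.1)))

theorem IsReduced.tail {S : ∀ e : E, Set (Γv (ι e))} {p : Σ e : E, Γv (ι e)}
    {r : List (Σ e : E, Γv (ι e))} (h : IsReduced bar S (p :: r)) : IsReduced bar S r :=
  ⟨fun q hq => h.1 q (List.mem_cons_of_mem _ hq), h.2.tail⟩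

theorem IsReduced.ne_one {S : ∀ e : E, Set (Γv (ι e))} {p q : Σ e : E, Γv (ι e)}
    {r : List (Σ e : E, Γv (ι e))} (h : IsReduced bar S (q :: p :: r)) (hq : q.1 = bar p.1) :
    q.2 ≠ 1 :=
  (List.isChain_cons_cons.1 h.2).1 hq

theorem IsReduced.cons {S : ∀ e : E, Set (Γv (ι e))} {e : E} {s : Γv (ι e)}
    {r : List (Σ e : E, Γv (ι e))} (h : IsReduced bar S r) (hs : s ∈ S e)
    (hne : ∀ p r', r = p :: r' → e = bar p.1 → s ≠ 1) : IsReduced bar S (⟨e, s⟩ :: r) := by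
  refine ⟨by simpa [hs] using h.1, ?_⟩
  cases r with
  | nil => exact List.isChain_singleton _
  | cons p r => exact List.isChain_cons_cons.2 ⟨hne p r rfl, h.2⟩

open Classical in
/-- Right multiplication of a state by `x ∈ Γ_v`; states at other vertices are fixed. -/
noncomputable def mulVertex (v : V) (x : Γv v) (z : State ι Γv) : State ι Γv :=
  if h : z.1 = v then ⟨v, z.2.1, h ▸ z.2.2 * x⟩ else z

theorem mulVertex_mk (v : V) (x y : Γv v) (r : List (Σ e : E, Γv (ι e))) :
    mulVertex v x ⟨v, r, y⟩ = ⟨v, r, y * x⟩ := by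
  simp [mulVertex]

theorem mulVertex_of_ne {v : V} {x : Γv v} {z : State ι Γv} (h : z.1 ≠ v) :
    mulVertex v x z = z := by
  simp [mulVertex, h]

theorem mulVertex_list (v : V) (x : Γv v) (z : State ι Γv) :
    (mulVertex v x z).2.1 = z.2.1 := by
  obtain ⟨w, r, h⟩ := z
  by_cases hw : w = v
  · subst hw; rw [mulVertex_mk]
  · rw [mulVertex_of_ne (z := ⟨w, r, h⟩) hw]

theorem mulVertex_mulVertex (v : V) (x y : Γv v) (z : State ι Γv) :
    mulVertex v y (mulVertex v x z) = mulVertex v (x * y) z := by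
  obtain ⟨w, r, h⟩ := z
  by_cases hw : w = v
  · subst hw; simp [mulVertex_mk, mul_assoc]
  · simp [mulVertex_of_ne (z := ⟨w, r, h⟩) hw]

theorem mulVertex_one (v : V) (z : State ι Γv) : mulVertex v 1 z = z := by
  obtain ⟨w, r, h⟩ := z
  by_cases hw : w = v
  · subst hw; simp [mulVertex_mk]
  · exact mulVertex_of_ne hw

variable (ω : ∀ e, H e ≃* H (bar e)) (i : ∀ e, H e →* Γv (ι e)) (S : ∀ e : E, Set (Γv (ι e)))

open Classical in
/-- Right multiplication by the edge `e` of a state at `ι e`, put back in normal form. -/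
noncomputable def edgeStep (e : E) (r : List (Σ e : E, Γv (ι e))) (h : Γv (ι e)) :
    List (Σ e : E, Γv (ι e)) × Γv (ι (bar e)) :=
  if hp : ∃ (s : Γv (ι (bar e))) (r' : List (Σ e : E, Γv (ι e))) (k : H e),
      r = ⟨bar e, s⟩ :: r' ∧ h = i e k then
    (hp.choose_spec.choose, hp.choose * i (bar e) (ω e hp.choose_spec.choose_spec.choose))
  else if hq : ∃ s ∈ S e, ∃ k, h = s * i e k then
    (⟨e, hq.choose⟩ :: r, i (bar e) (ω e hq.choose_spec.2.choose))
  else (r, 1)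

open Classical in
/-- Right multiplication by `e` on states at `ι e`, by `bar e` on the remaining states at
`ι (bar e)`, and the identity elsewhere. -/
noncomputable def edgeAct (e : E) (z : State ι Γv) : State ι Γv :=
  if h : z.1 = ι e then ⟨ι (bar e), edgeStep ω i S e z.2.1 (h ▸ z.2.2)⟩
  else if h : z.1 = ι (bar e) then
    ⟨ι (bar (bar e)), edgeStep ω i S (bar e) z.2.1 (h ▸ z.2.2)⟩
  else z

variable {ω i S}

theorem edgeAct_fst {e : E} {z : State ι Γv} (h : z.1 = ι e) :
    (edgeAct ω i S e z).1 = ι (bar e) := by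
  simp [edgeAct, h]

theorem edgeAct_of_ne (hbar_bar : ∀ e, bar (bar e) = e) {e : E} {z : State ι Γv}
    (h : z.1 ≠ ι e) : edgeAct ω i S e z = edgeAct ω i S (bar e) z := by
  have h' : z.1 ≠ ι (bar (bar e)) := by rwa [hbar_bar]
  unfold edgeAct
  rw [dif_neg h, dif_neg h']

theorem edgeAct_of_ne_of_ne {e : E} {z : State ι Γv}
    (h : z.1 ≠ ι e) (h' : z.1 ≠ ι (bar e)) : edgeAct ω i S e z = z := by
  unfold edgeAct
  rw [dif_neg h, dif_neg h']

theorem edgeAct_pop (hinj : ∀ e, Function.Injective (i e)) {e f : E} (hf : f = bar e)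
    (s : Γv (ι f)) (r : List (Σ e : E, Γv (ι e))) (k : H e) (k' : H f) (hk : k' ≍ ω e k) :
    edgeAct ω i S e ⟨ι e, ⟨f, s⟩ :: r, i e k⟩ = ⟨ι f, r, s * i f k'⟩ := by
  subst hf
  cases hk
  have hp : ∃ (s' : Γv (ι (bar e))) (r' : List (Σ e : E, Γv (ι e))) (k' : H e),
      (⟨bar e, s⟩ :: r : List (Σ e : E, Γv (ι e))) = ⟨bar e, s'⟩ :: r' ∧ i e k = i e k' :=
    ⟨s, r, k, rfl, rfl⟩
  have h₁ := hp.choose_spec.choose_spec.choose_spec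
  have h₂ := hinj _ h₁.2
  obtain ⟨h₃, h₄⟩ := List.cons.inj h₁.1
  unfold edgeAct
  rw [dif_pos rfl]
  unfold edgeStep
  rw [dif_pos hp, ← h₂, ← h₄, ← eq_of_heq (Sigma.mk.inj h₃).2]

theorem edgeAct_push (hinj : ∀ e, Function.Injective (i e))
    (hS1 : ∀ e, (1 : Γv (ι e)) ∈ S e)
    (hS : ∀ (e : E) (g : Γv (ι e)), ∃! s : Γv (ι e), s ∈ S e ∧ ∃ h : H e, g = s * i e h)
    {e : E} {s : Γv (ι e)} (hs : s ∈ S e) {r : List (Σ e : E, Γv (ι e))}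
    (hne : ∀ p r', r = p :: r' → p.1 = bar e → s ≠ 1) (k : H e) :
    edgeAct ω i S e ⟨ι e, r, s * i e k⟩ = ⟨ι (bar e), ⟨e, s⟩ :: r, i (bar e) (ω e k)⟩ := by
  have hq : ∃ s' ∈ S e, ∃ k', s * i e k = s' * i e k' := ⟨s, hs, k, rfl⟩
  have h₁ : s = hq.choose := (hS e (s * i e k)).unique ⟨hs, k, rfl⟩ hq.choose_spec
  have h₂ := hq.choose_spec.2.choose_spec
  have h₃ := hinj _ (mul_left_cancel (h₂.trans (congrArg (· * _) h₁.symm)))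
  unfold edgeAct
  rw [dif_pos rfl]
  unfold edgeStep
  rw [dif_neg, dif_pos hq, ← h₃, ← h₁]
  rintro ⟨s', r', k', hr, hk⟩
  refine hne _ _ hr rfl ((hS e (s * i e k)).unique ⟨hs, k, rfl⟩ ⟨hS1 e, k', ?_⟩)
  simpa using hk

/-- Every state at `ι e` falls under `edgeAct_pop` or `edgeAct_push`. -/
theorem pop_or_push
    (hS : ∀ (e : E) (g : Γv (ι e)), ∃! s : Γv (ι e), s ∈ S e ∧ ∃ h : H e, g = s * i e h)
    (e : E) (r : List (Σ e : E, Γv (ι e))) (h : Γv (ι e)) :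
    (∃ (s : Γv (ι (bar e))) (r' : List (Σ e : E, Γv (ι e))) (k : H e),
      r = ⟨bar e, s⟩ :: r' ∧ h = i e k) ∨
    ∃ s ∈ S e, (∀ p r', r = p :: r' → p.1 = bar e → s ≠ 1) ∧ ∃ k, h = s * i e k := by
  obtain ⟨s, ⟨hs, k, rfl⟩, -⟩ := hS e h
  by_cases hne : ∀ p r', r = p :: r' → p.1 = bar e → s ≠ 1
  · exact .inr ⟨s, hs, hne, k, rfl⟩
  · push Not at hne
    obtain ⟨⟨f, s'⟩, r', rfl, rfl, rfl⟩ := hne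
    exact .inl ⟨s', r', k, rfl, by simp⟩

theorem state_mk_congr {e f : E} (hf : f = e) {k : H e} {k' : H f} (hk : k' ≍ k)
    (r : List (Σ e : E, Γv (ι e))) :
    (⟨ι f, r, i f k'⟩ : State ι Γv) = ⟨ι e, r, i e k⟩ := by
  subst hf; cases hk; rfl

theorem edgeAct_near (hbar_bar : ∀ e, bar (bar e) = e)
    (hinj : ∀ e, Function.Injective (i e)) (hS1 : ∀ e, (1 : Γv (ι e)) ∈ S e)
    (hS : ∀ (e : E) (g : Γv (ι e)), ∃! s : Γv (ι e), s ∈ S e ∧ ∃ h : H e, g = s * i e h)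
    (e : E) (z : State ι Γv) (hz : IsReduced bar S z.2.1) :
    Near z.2.1 (edgeAct ω i S e z).2.1 ∧ IsReduced bar S (edgeAct ω i S e z).2.1 := by
  have key : ∀ (e : E) (r : List (Σ e : E, Γv (ι e))) (h : Γv (ι e)), IsReduced bar S r →
      Near r (edgeAct ω i S e ⟨ι e, r, h⟩).2.1 ∧
        IsReduced bar S (edgeAct ω i S e ⟨ι e, r, h⟩).2.1 := by
    intro e r h hr
    rcases pop_or_push (bar := bar) hS e r h with ⟨s, r', k, rfl, rfl⟩ | ⟨s, hs, hne, k, rfl⟩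
    · rw [edgeAct_pop hinj rfl s r' k _ HEq.rfl]
      exact ⟨.inr (.inr ⟨_, rfl⟩), hr.tail⟩
    · rw [edgeAct_push hinj hS1 hS hs hne]
      exact ⟨.inr (.inl ⟨_, rfl⟩), hr.cons hs fun p r' hp he =>
        hne p r' hp (by rw [he, hbar_bar])⟩
  obtain ⟨v, r, h⟩ := z
  by_cases h₁ : v = ι e
  · subst h₁; exact key e r h hz
  by_cases h₂ : v = ι (bar e)
  · rw [edgeAct_of_ne hbar_bar h₁]
    subst h₂; exact key (bar e) r h hz
  · rw [edgeAct_of_ne_of_ne h₁ h₂]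
    exact ⟨.inl rfl, hz⟩

theorem edgeAct_bar (hbar_bar : ∀ e, bar (bar e) = e)
    (hω : ∀ (e : E) (h : H e), HEq (ω (bar e) (ω e h)) h)
    (hinj : ∀ e, Function.Injective (i e)) (hS1 : ∀ e, (1 : Γv (ι e)) ∈ S e)
    (hS : ∀ (e : E) (g : Γv (ι e)), ∃! s : Γv (ι e), s ∈ S e ∧ ∃ h : H e, g = s * i e h)
    (e : E) (z : State ι Γv) (hz : IsReduced bar S z.2.1) :
    edgeAct ω i S (bar e) (edgeAct ω i S e z) = z := by
  have key : ∀ (e : E) (r : List (Σ e : E, Γv (ι e))) (h : Γv (ι e)), IsReduced bar S r →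
      edgeAct ω i S (bar e) (edgeAct ω i S e ⟨ι e, r, h⟩) = ⟨ι e, r, h⟩ := by
    intro e r h hr
    rcases pop_or_push (bar := bar) hS e r h with ⟨s, r', k, rfl, rfl⟩ | ⟨s, hs, hne, k, rfl⟩
    · rw [edgeAct_pop hinj rfl s r' k _ HEq.rfl,
        edgeAct_push hinj hS1 hS (hr.1 _ List.mem_cons_self)]
      · exact state_mk_congr (hbar_bar e) (hω e k) _
      · rintro p r'' rfl hp
        exact hr.ne_one (by rw [hp, hbar_bar])
    · rw [edgeAct_push hinj hS1 hS hs hne,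
        edgeAct_pop hinj (hbar_bar e).symm s r _ k (hω e k).symm]
  obtain ⟨v, r, h⟩ := z
  by_cases h₁ : v = ι e
  · subst h₁; exact key e r h hz
  by_cases h₂ : v = ι (bar e)
  · subst h₂
    rw [edgeAct_of_ne hbar_bar (z := ⟨ι (bar e), r, h⟩) h₁, edgeAct_of_ne hbar_bar]
    · exact key (bar e) r h hz
    · rw [edgeAct_fst rfl, hbar_bar]
      exact Ne.symm h₁
  · rw [edgeAct_of_ne_of_ne (z := ⟨v, r, h⟩) h₁ h₂]
    exact edgeAct_of_ne_of_ne h₂ (by rwa [hbar_bar])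

theorem edgeAct_mulVertex (hbar_bar : ∀ e, bar (bar e) = e)
    (hinj : ∀ e, Function.Injective (i e)) (hS1 : ∀ e, (1 : Γv (ι e)) ∈ S e)
    (hS : ∀ (e : E) (g : Γv (ι e)), ∃! s : Γv (ι e), s ∈ S e ∧ ∃ h : H e, g = s * i e h)
    (e : E) (k : H e) (z : State ι Γv) :
    edgeAct ω i S e (mulVertex (ι e) (i e k) z) =
      mulVertex (ι (bar e)) (i (bar e) (ω e k)) (edgeAct ω i S e z) := by
  obtain ⟨v, r, h⟩ := z
  by_cases h₁ : v = ι e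
  · subst h₁
    rw [mulVertex_mk]
    rcases pop_or_push (bar := bar) hS e r h with ⟨s, r', k', rfl, rfl⟩ | ⟨s, hs, hne, k', rfl⟩
    · rw [← map_mul, edgeAct_pop hinj rfl s r' _ _ HEq.rfl,
        edgeAct_pop hinj rfl s r' _ _ HEq.rfl, mulVertex_mk, map_mul, map_mul, mul_assoc]
    · rw [mul_assoc, ← map_mul, edgeAct_push hinj hS1 hS hs hne,
        edgeAct_push hinj hS1 hS hs hne, mulVertex_mk, map_mul, map_mul]
  rw [mulVertex_of_ne (z := ⟨v, r, h⟩) h₁]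
  by_cases h₂ : v = ι (bar e)
  · subst h₂
    rw [mulVertex_of_ne]
    rw [edgeAct_of_ne hbar_bar (z := ⟨ι (bar e), r, h⟩) h₁, edgeAct_fst rfl, hbar_bar]
    exact Ne.symm h₁
  · rw [edgeAct_of_ne_of_ne (z := ⟨v, r, h⟩) h₁ h₂, mulVertex_of_ne (z := ⟨v, r, h⟩) h₂]

end Action

section Tree
variable {V E : Type} {ι : E → V} {bar : E → E} {Γv : V → Type}
    [∀ v, Group (Γv v)] {H : E → Type} [∀ e, Group (H e)] {ω : ∀ e, H e ≃* H (bar e)}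
    {i : ∀ e, H e →* Γv (ι e)} {Etree : Set E} {S : ∀ e : E, Set (Γv (ι e))}

theorem isReduced_reverse {c : V} {l : List (Σ e : E, Γv (ι e))}
    (hl : IsNormalForm ι bar Γv S c l) : IsReduced bar S l.reverse :=
  ⟨fun p hp => hl.2.1 p (List.mem_reverse.1 hp), List.isChain_reverse.2 hl.2.2⟩

/-- The Bass–Serre tree maps to the tree of reduced syllable lists, and a coset `gΓ_c` of a
normal form `g` is sent to the list of syllables of `g`. -/
theorem exists_syllables
    (hbar_bar : ∀ e, bar (bar e) = e)
    (hω : ∀ (e : E) (h : H e), HEq (ω (bar e) (ω e h)) h)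
    (hinj : ∀ e, Function.Injective (i e))
    (htree_bar : ∀ e ∈ Etree, bar e ∈ Etree)
    (htree_conn : ∀ v w : V, ∃ p : List E, (∀ e ∈ p, e ∈ Etree) ∧ IsEdgePath ι bar v p w)
    (htree_acyc : ∀ (v : V) (p : List E), p ≠ [] → (∀ e ∈ p, e ∈ Etree) →
      p.IsChain (fun e f => f ≠ bar e) → IsEdgePath ι bar v p v → False)
    (c : V) (hS1 : ∀ e, (1 : Γv (ι e)) ∈ S e)
    (hS : ∀ (e : E) (g : Γv (ι e)), ∃! s : Γv (ι e), s ∈ S e ∧ ∃ h : H e, g = s * i e h) :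
    ∃ f : bsVert ι bar Γv H ω i Etree → List (Σ e : E, Γv (ι e)),
      (∀ x y, bsAdj ι bar Γv H ω i Etree x y → Near (f x) (f y)) ∧
      ∀ l x, IsNormalForm ι bar Γv S c l →
        f ⟨c, QuotientGroup.mk (nfWord ι bar Γv H ω i Etree l *
          embV ι bar Γv H ω i Etree c x)⟩ = l.reverse := by
  let Ω := {z : State ι Γv // IsReduced bar S z.2.1}
  let A : ∀ v, Γv v → Ω → Ω := fun v x z =>
    ⟨mulVertex v x z.1, (mulVertex_list v x z.1).symm ▸ z.2⟩
  have hA : ∀ v x y z, A v y (A v x z) = A v (x * y) z := fun v x y z =>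
    Subtype.ext (mulVertex_mulVertex v x y z.1)
  have hA1 : ∀ v z, A v 1 z = z := fun v z => Subtype.ext (mulVertex_one v z.1)
  let B : E → Ω → Ω := fun e z =>
    ⟨edgeAct ω i S e z.1, (edgeAct_near hbar_bar hinj hS1 hS e z.1 z.2).2⟩
  have hB : ∀ e z, B (bar e) (B e z) = z := fun e z =>
    Subtype.ext (edgeAct_bar hbar_bar hω hinj hS1 hS e z.1 z.2)
  let a : ∀ v, Γv v →* (Equiv.Perm Ω)ᵐᵒᵖ := fun v => MonoidHom.mk' (fun x => .op
      ⟨A v x, A v x⁻¹, fun z => by rw [hA, mul_inv_cancel, hA1],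
        fun z => by rw [hA, inv_mul_cancel, hA1]⟩) fun x y =>
      MulOpposite.unop_injective (Equiv.ext fun z => (hA v x y z).symm)
  let b : E → (Equiv.Perm Ω)ᵐᵒᵖ := fun e => .op ⟨B e, B (bar e), hB e, fun z => by
    simpa only [hbar_bar] using hB (bar e) z⟩
  obtain ⟨φ, τ, hτ, hφV, hφE⟩ := exists_hom (ω := ω) (i := i) hbar_bar htree_bar htree_conn
    htree_acyc c a b
    (fun e => MulOpposite.unop_injective (Equiv.ext (hB e)))
    (fun e k => MulOpposite.unop_injective (Equiv.ext fun z => Subtype.ext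
      (edgeAct_mulVertex hbar_bar hinj hS1 hS e k z.1)))
  let z₀ : Ω := ⟨⟨c, [], 1⟩, by simp, List.isChain_nil⟩
  let F : (Equiv.Perm Ω)ᵐᵒᵖ → List (Σ e : E, Γv (ι e)) := fun g => (g.unop z₀).1.2.1
  have hFa : ∀ g v x, F (g * a v x) = F g := fun g v x => mulVertex_list v x _
  have hFb : ∀ g e, Near (F g) (F (g * b e)) := fun g e =>
    (edgeAct_near hbar_bar hinj hS1 hS e _ (g.unop z₀).2).1
  have hF : ∀ v, ∀ k ∈ Subgroup.closure (Set.range (embV ι bar Γv H ω i Etree v)), ∀ g,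
      F (φ (g * k) * τ v) = F (φ g * τ v) := by
    intro v k hk
    induction hk using Subgroup.closure_induction with
    | mem k hk =>
      obtain ⟨x, rfl⟩ := hk
      intro g
      rw [map_mul, mul_assoc, hφV, ← mul_assoc, hFa]
    | one => simp
    | mul k k' _ _ h h' => intro g; rw [← mul_assoc, h', h]
    | inv k _ h => intro g; rw [← h, inv_mul_cancel_right]
  let f : bsVert ι bar Γv H ω i Etree → List (Σ e : E, Γv (ι e)) := fun x =>
    Quotient.liftOn' x.2 (fun g => F (φ g * τ x.1)) fun g g' hg => by
      rw [QuotientGroup.leftRel_apply] at hg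
      rw [← hF x.1 _ hg, mul_inv_cancel_left]
  have hf : ∀ v g, f ⟨v, QuotientGroup.mk g⟩ = F (φ g * τ v) := fun v g => rfl
  have hf1 : ∀ x y, bsAdjOne ι bar Γv H ω i Etree x y → Near (f x) (f y) := by
    rintro x y ⟨e, g, rfl, rfl⟩
    rw [hf, hf, map_mul, mul_assoc, hφE, ← mul_assoc]
    exact hFb _ _
  refine ⟨f, fun x y h => h.elim (hf1 x y) fun h => (hf1 y x h).symm, ?_⟩
  have hword : ∀ (l : List (Σ e : E, Γv (ι e))) (w : V), IsEdgePath ι bar c (l.map Sigma.fst) w →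
      IsReduced bar S l.reverse →
      ((φ (nfWord ι bar Γv H ω i Etree l) * τ w).unop z₀).1 = ⟨w, l.reverse, 1⟩ := by
    intro l
    induction l using List.reverseRecOn with
    | nil =>
      rintro w rfl -
      simp [nfWord, hτ, z₀]
    | append_singleton l p ih =>
      obtain ⟨e, s⟩ := p
      intro w hw hl
      rw [List.map_append, isEdgePath_append] at hw
      obtain ⟨u, hu, rfl, rfl⟩ := hw
      rw [List.reverse_append] at hl ⊢
      have h₁ : φ (nfWord ι bar Γv H ω i Etree (l ++ [⟨e, s⟩])) * τ (ι (bar e)) =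
          φ (nfWord ι bar Γv H ω i Etree l) * τ (ι e) * a (ι e) s * b e := by
        have : nfWord ι bar Γv H ω i Etree (l ++ [⟨e, s⟩]) = nfWord ι bar Γv H ω i Etree l *
            (embV ι bar Γv H ω i Etree (ι e) s * embE ι bar Γv H ω i Etree e) := by
          simp [nfWord]
        rw [this, map_mul, map_mul, mul_assoc, mul_assoc, hφE, ← mul_assoc (φ _) (τ _), hφV]
        simp only [mul_assoc]
      rw [h₁]
      change edgeAct ω i S e (mulVertex (ι e) s
        ((φ (nfWord ι bar Γv H ω i Etree l) * τ (ι e)).unop z₀).1) = _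
      have h₂ := edgeAct_push (ω := ω) hinj hS1 hS (hl.1 _ List.mem_cons_self)
        (r := l.reverse) (fun p r' hr hp => by
          refine IsReduced.ne_one (p := p) (r := r') (hr ▸ hl) ?_
          rw [hp, hbar_bar]) 1
      rw [ih _ hu hl.tail, mulVertex_mk, one_mul]
      simpa using h₂
  intro l x hl
  rw [hf, hF c _ (Subgroup.subset_closure ⟨x, rfl⟩)]
  exact congrArg (fun z : State ι Γv => z.2.1) (hword l c hl.1 (isReduced_reverse hl))

theorem mk_mul_embV (v : V) (g : GoGFundGroup ι bar Γv H ω i Etree) (x : Γv v) :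
    (⟨v, QuotientGroup.mk (g * embV ι bar Γv H ω i Etree v x)⟩ :
      bsVert ι bar Γv H ω i Etree) = ⟨v, QuotientGroup.mk g⟩ := by
  congr 1
  exact QuotientGroup.mk_mul_of_mem _ (Subgroup.subset_closure ⟨x, rfl⟩)

theorem exists_relPath_nfWord (l : List (Σ e : E, Γv (ι e))) {v w : V}
    (hl : IsEdgePath ι bar v (l.map Sigma.fst) w) (g : GoGFundGroup ι bar Γv H ω i Etree) :
    ∃ p, relPath (bsAdj ι bar Γv H ω i Etree) ⟨v, QuotientGroup.mk g⟩ p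
      ⟨w, QuotientGroup.mk (g * nfWord ι bar Γv H ω i Etree l)⟩ := by
  induction l generalizing v g with
  | nil =>
    cases hl
    exact ⟨[], by simp only [nfWord, List.map_nil, List.prod_nil, mul_one]; rfl⟩
  | cons q l ih =>
    obtain ⟨e, s⟩ := q
    obtain ⟨rfl, hl⟩ := hl
    obtain ⟨p, hp⟩ := ih hl
      (g * embV ι bar Γv H ω i Etree (ι e) s * embE ι bar Γv H ω i Etree e)
    refine ⟨_ :: p, .inl ⟨e, g * embV ι bar Γv H ω i Etree (ι e) s,
      (mk_mul_embV _ _ _).symm, rfl⟩, ?_⟩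
    simpa [nfWord, mul_assoc] using hp

end Tree

end GraphOfGroups

/-- Let `V = T·T_V·U_V` and `W = T·T_W·U_W` be two words of the language `L` (normal-form
tree part followed by a word representing an element of the base vertex group `Γ_c`),
where `T` is the longest common syllable prefix of the two tree parts.  If the images of
`V` and `W` move the Bass–Serre base vertex `c̃` to vertices at tree distance at most
`η`, then the total number of remaining syllables satisfies `(n−j)+(m−j) ≤ η`. -/
theorem branch_syllables_bound {V E : Type} [Fintype V] [Fintype E]
    (ι : E → V) (bar : E → E)
    (hbar_bar : ∀ e, bar (bar e) = e) (hbar_ne : ∀ e, bar e ≠ e)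
    (Γv : V → Type) [∀ v, Group (Γv v)] (H : E → Type) [∀ e, Group (H e)]
    (ω : ∀ e, H e ≃* H (bar e))
    (hω : ∀ (e : E) (h : H e), HEq (ω (bar e) (ω e h)) h)
    (i : ∀ e, H e →* Γv (ι e)) (hinj : ∀ e, Function.Injective (i e))
    (Etree : Set E)
    (htree_bar : ∀ e ∈ Etree, bar e ∈ Etree)
    (htree_conn : ∀ v w : V, ∃ p : List E, (∀ e ∈ p, e ∈ Etree) ∧ IsEdgePath ι bar v p w)
    (htree_acyc : ∀ (v : V) (p : List E), p ≠ [] → (∀ e ∈ p, e ∈ Etree) →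
      p.Chain' (fun e f => f ≠ bar e) → IsEdgePath ι bar v p v → False)
    (c : V) (S : ∀ e : E, Set (Γv (ι e)))
    (hS1 : ∀ e, (1 : Γv (ι e)) ∈ S e)
    (hS : ∀ (e : E) (g : Γv (ι e)), ∃! s : Γv (ι e), s ∈ S e ∧ ∃ h : H e, g = s * i e h)
    (T lV lW : List (Σ e : E, Γv (ι e))) (hV hW : Γv c)
    (hnfV : IsNormalForm ι bar Γv S c (T ++ lV))
    (hnfW : IsNormalForm ι bar Γv S c (T ++ lW))
    (hmax : ∀ x : Σ e : E, Γv (ι e), lV.head? = some x → lW.head? ≠ some x)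
    (η : ℕ)
    (hdist : relDist (bsAdj ι bar Γv H ω i Etree)
      ⟨c, QuotientGroup.mk (nfWord ι bar Γv H ω i Etree (T ++ lV) *
            embV ι bar Γv H ω i Etree c hV)⟩
      ⟨c, QuotientGroup.mk (nfWord ι bar Γv H ω i Etree (T ++ lW) *
            embV ι bar Γv H ω i Etree c hW)⟩ ≤ η) :
    lV.length + lW.length ≤ η := by
  obtain ⟨f, hf, hfl⟩ := GraphOfGroups.exists_syllables (Etree := Etree) hbar_bar hω hinj
    htree_bar htree_conn htree_acyc c hS1 hS
  have hsymm : ∀ x y, bsAdj ι bar Γv H ω i Etree x y → bsAdj ι bar Γv H ω i Etree y x :=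
    fun _ _ => Or.symm
  obtain ⟨p₁, hp₁⟩ := GraphOfGroups.exists_relPath_nfWord (ω := ω) (i := i) (Etree := Etree)
    _ hnfV.1 1
  obtain ⟨p₂, hp₂⟩ := GraphOfGroups.exists_relPath_nfWord (ω := ω) (i := i) (Etree := Etree)
    _ hnfW.1 1
  obtain ⟨q₁, hq₁⟩ := GraphOfGroups.exists_relPath_symm hsymm hp₁
  have hpath := GraphOfGroups.relPath_append hq₁ hp₂
  rw [one_mul, one_mul, ← GraphOfGroups.mk_mul_embV c (nfWord ι bar Γv H ω i Etree (T ++ lV)) hV,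
    ← GraphOfGroups.mk_mul_embV c (nfWord ι bar Γv H ω i Etree (T ++ lW)) hW] at hpath
  obtain ⟨p, hp, hpR⟩ := Nat.sInf_mem (s := {n : ℕ | ∃ p, p.length = n ∧
    relPath (bsAdj ι bar Γv H ω i Etree) _ p _}) ⟨_, _, rfl, hpath⟩
  obtain ⟨a, b, P, ha, hb, hab⟩ := GraphOfGroups.exists_common_tail hf (T ++ lV).reverse p _ _
    [] [] (T ++ lV).reverse rfl (hfl _ _ hnfV) hpR
  rw [hfl _ _ hnfW] at hb
  have key := GraphOfGroups.length_le_of_append_eq (P := P.reverse) (a := a.reverse)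
    (b := b.reverse) hmax (by simpa using congrArg List.reverse ha)
    (by simpa using congrArg List.reverse hb)
  unfold relDist at hdist
  simp only [List.length_reverse, List.length_nil] at key hab
  omega
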